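/- arXiv:1803.00186 — 4 statements merged into one kernel-verified Lean document; each statement's English description precedes it below -/
import Mathlib

section
/- Let f : Sym(n) → ℝ be a convex, twice continuously differentiable function on the space of real symmetric n×n matrices, and for a positive integer k define g : ℝ^{n×k} → ℝ by g(U) = f(UUᵀ). If U ∈ ℝ^{n×k} is a second-order stationary point of g (i.e., ∇g(U) = 0 and ∇²g(U) ⪰ 0) with rank(U) < k, then U is a global minimizer of g over ℝ^{n×k}, and X = UUᵀ is a global minimizer of f over the cone of positive semidefinite n×n matrices. -/
open Matrix

attribute [local instance] Matrix.normedAddCommGroup Matrix.normedSpace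

theorem exists_mulVec_eq_zero_of_rank_lt {m k : ℕ} (U : Matrix (Fin m) (Fin k) ℝ)
    (hrank : U.rank < k) : ∃ z : Fin k → ℝ, z ≠ 0 ∧ U *ᵥ z = 0 := by
  by_contra! h
  have hinj : Function.Injective U.mulVecLin := by
    rw [injective_iff_map_eq_zero]
    intro z hz
    by_contra hne
    exact h z hne hz
  have := LinearMap.finrank_range_of_inj hinj
  rw [Module.finrank_fin_fun] at this
  exact hrank.ne this

theorem contDiff_mul_transpose_self {n k : ℕ} {r : WithTop ℕ∞} :
    ContDiff ℝ r (fun V : Matrix (Fin n) (Fin k) ℝ => V * Vᵀ) := by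
  refine contDiff_pi.2 fun i => contDiff_pi.2 fun j => ?_
  simp only [Matrix.mul_apply, Matrix.transpose_apply]
  exact ContDiff.sum fun l _ =>
    (contDiff_apply_apply ℝ ℝ i l).mul (contDiff_apply_apply ℝ ℝ j l)

theorem Matrix.PosSemidef.exists_eq_sum_vecMulVec {n : ℕ} {Y : Matrix (Fin n) (Fin n) ℝ}
    (hY : Y.PosSemidef) : ∃ b : Fin n → Fin n → ℝ, Y = ∑ i, vecMulVec (b i) (b i) := by
  obtain ⟨B, rfl⟩ : ∃ B : Matrix (Fin n) (Fin n) ℝ, Y = Bᴴ * B := by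
    open scoped ComplexOrder MatrixOrder in
    exact CStarAlgebra.nonneg_iff_eq_star_mul_self.mp hY.nonneg
  refine ⟨B, ?_⟩
  ext i j
  simp [Matrix.mul_apply, Matrix.sum_apply, vecMulVec_apply]

/-- A convex function with nonnegative derivative at `x` in the direction `y - x` satisfies
`f x ≤ f y`. -/
theorem ConvexOn.le_of_fderiv_sub_nonneg {E : Type*} [NormedAddCommGroup E] [NormedSpace ℝ E]
    {s : Set E} {f : E → ℝ} (hf : ConvexOn ℝ s f) {x y : E} (hx : x ∈ s) (hy : y ∈ s)
    (hd : DifferentiableAt ℝ f x) (h : 0 ≤ fderiv ℝ f x (y - x)) : f x ≤ f y := by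
  have hc := hf.comp_affineMap (AffineMap.lineMap x y : ℝ →ᵃ[ℝ] E)
  have hl : HasDerivAt (AffineMap.lineMap x y : ℝ → E) (y - x) 0 :=
    AffineMap.hasDerivAt_lineMap
  have hφ : HasDerivAt (f ∘ (AffineMap.lineMap x y : ℝ →ᵃ[ℝ] E)) (fderiv ℝ f x (y - x)) 0 := by
    refine HasFDerivAt.comp_hasDerivAt 0 ?_ hl
    simpa using hd.hasFDerivAt
  have := hc.le_slope_of_hasDerivAt (x := 0) (y := 1) (by simpa using hx) (by simpa using hy)
    one_pos hφ
  have h01 : 0 ≤ f y - f x := by simpa [slope_def_field] using h.trans this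
  linarith

/-- If `g` agrees with `t ↦ f (x + t² • d)` along the line `t ↦ u + t • v`, then its second
derivative at `u` in the direction `v` is twice the derivative of `f` at `x` along `d`. -/
theorem iteratedFDeriv_two_eq_of_comp_sq {E F : Type*} [NormedAddCommGroup E] [NormedSpace ℝ E]
    [NormedAddCommGroup F] [NormedSpace ℝ F] {f : E → ℝ} {g : F → ℝ} (hf : ContDiff ℝ 2 f)
    (hg : ContDiff ℝ 2 g) {u v : F} {x d : E}
    (h : ∀ t : ℝ, g (u + t • v) = f (x + t ^ 2 • d)) :
    iteratedFDeriv ℝ 2 g u ![v, v] = 2 * fderiv ℝ f x d := by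
  have hf' : Differentiable ℝ (fderiv ℝ f) :=
    (hf.fderiv_right (m := 1) (by norm_num)).differentiable (by norm_num)
  have hg' : Differentiable ℝ (fderiv ℝ g) :=
    (hg.fderiv_right (m := 1) (by norm_num)).differentiable (by norm_num)
  have hline : ∀ t : ℝ, HasDerivAt (fun t : ℝ => u + t • v) v t := fun t => by
    simpa using ((hasDerivAt_id t).smul_const v).const_add u
  have hparab : ∀ t : ℝ, HasDerivAt (fun t : ℝ => x + t ^ 2 • d) ((2 * t) • d) t := fun t => by
    simpa using ((hasDerivAt_pow 2 t).smul_const d).const_add x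
  have hfirst : ∀ t : ℝ, fderiv ℝ g (u + t • v) v = 2 * t * fderiv ℝ f (x + t ^ 2 • d) d := by
    intro t
    have h₁ := ((hg.differentiable (by norm_num)) (u + t • v)).hasFDerivAt.comp_hasDerivAt t
      (hline t)
    have h₂ := ((hf.differentiable (by norm_num)) (x + t ^ 2 • d)).hasFDerivAt.comp_hasDerivAt t
      (hparab t)
    have he : g ∘ (fun t : ℝ => u + t • v) = f ∘ (fun t : ℝ => x + t ^ 2 • d) := funext h
    rw [he] at h₁
    simpa using h₁.unique h₂
  have hL : HasDerivAt (fun t : ℝ => fderiv ℝ g (u + t • v) v)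
      (fderiv ℝ (fderiv ℝ g) u v v) 0 := by
    have h₀ := (hg' (u + (0 : ℝ) • v)).hasFDerivAt.comp_hasDerivAt (0 : ℝ) (hline 0)
    simpa using h₀.clm_apply (hasDerivAt_const (0 : ℝ) v)
  have hR : HasDerivAt (fun t : ℝ => 2 * t * fderiv ℝ f (x + t ^ 2 • d) d)
      (2 * fderiv ℝ f x d) 0 := by
    have h₀ := (hf' (x + (0 : ℝ) ^ 2 • d)).hasFDerivAt.comp_hasDerivAt (0 : ℝ) (hparab 0)
    have h₁ := h₀.clm_apply (hasDerivAt_const (0 : ℝ) d)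
    have h₂ := ((hasDerivAt_id (0 : ℝ)).const_mul 2).fun_mul h₁
    simpa using h₂
  rw [iteratedFDeriv_two_apply]
  simp only [funext hfirst] at hL
  simpa using hL.unique hR

/-- Euler-type identity: if `g (c • u) = f (c² • x)` for all `c`, then the derivative of `g` at `u`
along `u` is twice the derivative of `f` at `x` along `x`. -/
theorem fderiv_apply_self_eq_of_comp_smul {E F : Type*} [NormedAddCommGroup E] [NormedSpace ℝ E]
    [NormedAddCommGroup F] [NormedSpace ℝ F] {f : E → ℝ} {g : F → ℝ} {u : F} {x : E}
    (hg : DifferentiableAt ℝ g u) (hf : DifferentiableAt ℝ f x)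
    (h : ∀ c : ℝ, g (c • u) = f (c ^ 2 • x)) :
    fderiv ℝ g u u = 2 * fderiv ℝ f x x := by
  have hline : HasDerivAt (fun c : ℝ => c • u) u 1 := by
    simpa using (hasDerivAt_id (1 : ℝ)).smul_const u
  have hquad : HasDerivAt (fun c : ℝ => c ^ 2 • x) ((2 : ℝ) • x) 1 := by
    simpa using (hasDerivAt_pow 2 (1 : ℝ)).smul_const x
  have h₁ : HasDerivAt (g ∘ fun c : ℝ => c • u) (fderiv ℝ g u u) 1 :=
    HasFDerivAt.comp_hasDerivAt 1 (by simpa using hg.hasFDerivAt) hline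
  have h₂ : HasDerivAt (f ∘ fun c : ℝ => c ^ 2 • x) (fderiv ℝ f x ((2 : ℝ) • x)) 1 :=
    HasFDerivAt.comp_hasDerivAt 1 (by simpa using hf.hasFDerivAt) hquad
  have he : (g ∘ fun c : ℝ => c • u) = f ∘ fun c : ℝ => c ^ 2 • x := funext h
  rw [he] at h₁
  simpa using h₁.unique h₂

/-- If `f : Sym(n) → ℝ` is convex and twice continuously differentiable and
`g(U) = f (U Uᵀ)`, then any rank-deficient second-order stationary point `U` of `g`
(`∇g(U) = 0` and `∇²g(U) ⪰ 0`) is a global minimizer of `g`, and `U Uᵀ` is a global minimizer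
of `f` over the positive semidefinite cone. -/
theorem exact_rank_deficient_sosp_is_global {n k : ℕ}
    (f : Matrix (Fin n) (Fin n) ℝ → ℝ)
    (hconv : ConvexOn ℝ {X : Matrix (Fin n) (Fin n) ℝ | X.IsSymm} f)
    (hsmooth : ContDiff ℝ 2 f)
    (U : Matrix (Fin n) (Fin k) ℝ)
    (hgrad : fderiv ℝ (fun V : Matrix (Fin n) (Fin k) ℝ => f (V * Vᵀ)) U = 0)
    (hhess : ∀ V : Matrix (Fin n) (Fin k) ℝ,
      0 ≤ iteratedFDeriv ℝ 2 (fun W : Matrix (Fin n) (Fin k) ℝ => f (W * Wᵀ)) U ![V, V])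
    (hrank : U.rank < k) :
    (∀ V : Matrix (Fin n) (Fin k) ℝ, f (U * Uᵀ) ≤ f (V * Vᵀ)) ∧
    (∀ X : Matrix (Fin n) (Fin n) ℝ, X.PosSemidef → f (U * Uᵀ) ≤ f X) := by
  have hg : ContDiff ℝ 2 (fun W : Matrix (Fin n) (Fin k) ℝ => f (W * Wᵀ)) :=
    hsmooth.comp contDiff_mul_transpose_self
  have hdf : Differentiable ℝ f := hsmooth.differentiable (by norm_num)
  have hself : fderiv ℝ f (U * Uᵀ) (U * Uᵀ) = 0 := by
    have h : fderiv ℝ (fun W : Matrix (Fin n) (Fin k) ℝ => f (W * Wᵀ)) U U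
        = 2 * fderiv ℝ f (U * Uᵀ) (U * Uᵀ) := by
      refine fderiv_apply_self_eq_of_comp_smul (hg.differentiable (by norm_num) U)
        (hdf (U * Uᵀ)) fun c => ?_
      simp [smul_smul, pow_two]
    rw [hgrad] at h
    simpa using h.symm
  have hrankOne : ∀ x : Fin n → ℝ, 0 ≤ fderiv ℝ f (U * Uᵀ) (vecMulVec x x) := by
    intro x
    obtain ⟨z, hz, hUz⟩ := exists_mulVec_eq_zero_of_rank_lt U hrank
    have hpos : 0 < z ⬝ᵥ z := by simpa using dotProduct_star_self_pos_iff.2 hz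
    have hcross : U * vecMulVec z x = 0 := by
      rw [mul_vecMulVec, hUz, zero_vecMulVec]
    have hcross' : vecMulVec x z * Uᵀ = 0 := by
      rw [vecMulVec_mul, vecMul_transpose, hUz, vecMulVec_zero]
    have h := hhess (vecMulVec x z)
    rw [iteratedFDeriv_two_eq_of_comp_sq (x := U * Uᵀ) (d := (z ⬝ᵥ z) • vecMulVec x x)
      hsmooth hg] at h
    · rw [map_smul, smul_eq_mul] at h
      exact nonneg_of_mul_nonneg_right (nonneg_of_mul_nonneg_right h two_pos) hpos
    · intro t
      congr 1
      rw [transpose_add, transpose_smul, transpose_vecMulVec, Matrix.add_mul, Matrix.mul_add,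
        Matrix.mul_add]
      simp [hcross, hcross', vecMulVec_mul_vecMulVec, smul_smul, pow_two, mul_assoc]
  have hmin : ∀ X : Matrix (Fin n) (Fin n) ℝ, X.PosSemidef → f (U * Uᵀ) ≤ f X := by
    intro X hX
    have hU : (U * Uᵀ).IsSymm := by simp [IsSymm]
    have hXs : X.IsSymm := by simpa [IsHermitian, IsSymm] using hX.isHermitian
    have hnonneg : 0 ≤ fderiv ℝ f (U * Uᵀ) (X - U * Uᵀ) := by
      obtain ⟨b, rfl⟩ := hX.exists_eq_sum_vecMulVec
      rw [map_sub, hself, sub_zero, map_sum]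
      exact Finset.sum_nonneg fun i _ => hrankOne (b i)
    exact hconv.le_of_fderiv_sub_nonneg hU hXs (hdf _) hnonneg
  exact ⟨fun V => hmin _ (by simpa using posSemidef_self_mul_conjTranspose V), hmin⟩
end

section
/- Let C, A₁, …, A_m be real symmetric n×n matrices, b ∈ ℝ^m, μ > 0, and let L_μ(U) = ⟨C, UUᵀ⟩ + μ Σ_{i=1}^m (⟨A_i, UUᵀ⟩ − b_i)² for U ∈ ℝ^{n×k}. If k ≥ n+1, then every second-order stationary point U of L_μ is a global minimizer of L_μ over ℝ^{n×k}, and X = UUᵀ is a global minimizer of F_μ(X) = ⟨C,X⟩ + μ Σ_{i=1}^m (⟨A_i,X⟩ − b_i)² over the cone of positive semidefinite n×n matrices. -/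
open Matrix

attribute [local instance] Matrix.normedAddCommGroup Matrix.normedSpace

/-- Trace inner product `⟨A, B⟩ = Tr(Aᵀ B)` on square matrices. -/
noncomputable def mip {n : ℕ} (A B : Matrix (Fin n) (Fin n) ℝ) : ℝ := (Aᵀ * B).trace

/-- The trace pairing with a fixed matrix, as a linear functional. -/
noncomputable def mipLin {n : ℕ} (A : Matrix (Fin n) (Fin n) ℝ) :
    Matrix (Fin n) (Fin n) ℝ →ₗ[ℝ] ℝ where
  toFun := mip A
  map_add' X Y := by simp [mip, Matrix.mul_add]
  map_smul' r X := by simp [mip]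

theorem mipLin_apply {n : ℕ} (A X : Matrix (Fin n) (Fin n) ℝ) : mipLin A X = mip A X := rfl

/-- The penalized objective on the matrix space. -/
noncomputable def penalized {n m : ℕ} (C : Matrix (Fin n) (Fin n) ℝ)
    (A : Fin m → Matrix (Fin n) (Fin n) ℝ) (b : Fin m → ℝ) (μ : ℝ)
    (X : Matrix (Fin n) (Fin n) ℝ) : ℝ :=
  mip C X + μ * ∑ i, (mip (A i) X - b i) ^ 2

/-- The differential of `penalized` at `X`, as a linear functional. -/
noncomputable def penalizedDeriv {n m : ℕ} (C : Matrix (Fin n) (Fin n) ℝ)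
    (A : Fin m → Matrix (Fin n) (Fin n) ℝ) (b : Fin m → ℝ) (μ : ℝ)
    (X : Matrix (Fin n) (Fin n) ℝ) : Matrix (Fin n) (Fin n) ℝ →ₗ[ℝ] ℝ :=
  mipLin C + (2 * μ) • ∑ i, (mip (A i) X - b i) • mipLin (A i)

theorem penalized_add_smul {n m : ℕ} (C : Matrix (Fin n) (Fin n) ℝ)
    (A : Fin m → Matrix (Fin n) (Fin n) ℝ) (b : Fin m → ℝ) (μ : ℝ)
    (X D : Matrix (Fin n) (Fin n) ℝ) (r : ℝ) :
    penalized C A b μ (X + r • D) = penalized C A b μ X + r * penalizedDeriv C A b μ X D +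
      r ^ 2 * (μ * ∑ i, mip (A i) D ^ 2) := by
  have h (B : Matrix (Fin n) (Fin n) ℝ) : mip B (X + r • D) = mip B X + r * mip B D := by
    simp [mip, Matrix.mul_add]
  have e : penalizedDeriv C A b μ X D =
      mip C D + 2 * μ * ∑ i, (mip (A i) X - b i) * mip (A i) D := by
    simp [penalizedDeriv, mipLin_apply]
  have hs : ∑ i, (mip (A i) (X + r • D) - b i) ^ 2 = ∑ i, (mip (A i) X - b i) ^ 2 +
      2 * r * ∑ i, (mip (A i) X - b i) * mip (A i) D + r ^ 2 * ∑ i, mip (A i) D ^ 2 := by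
    rw [Finset.mul_sum, Finset.mul_sum, ← Finset.sum_add_distrib, ← Finset.sum_add_distrib]
    exact Finset.sum_congr rfl fun i _ => by rw [h]; ring
  rw [penalized, penalized, hs, h, e]
  ring

theorem contDiff_penalized_mul_transpose {n m k : ℕ} (C : Matrix (Fin n) (Fin n) ℝ)
    (A : Fin m → Matrix (Fin n) (Fin n) ℝ) (b : Fin m → ℝ) (μ : ℝ) :
    ContDiff ℝ 2 fun V : Matrix (Fin n) (Fin k) ℝ => penalized C A b μ (V * Vᵀ) := by
  have he (i : Fin n) (j : Fin k) : ContDiff ℝ 2 fun V : Matrix (Fin n) (Fin k) ℝ => V i j :=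
    contDiff_apply_apply ℝ ℝ i j
  simp only [penalized, mip, Matrix.trace, Matrix.diag, Matrix.mul_apply, Matrix.transpose_apply]
  fun_prop

theorem fderiv_apply_eq_of_line {E : Type*} [NormedAddCommGroup E] [NormedSpace ℝ E]
    {f : E → ℝ} {U V : E} (hf : DifferentiableAt ℝ f U) {p : ℝ → ℝ} {p' : ℝ}
    (hline : ∀ t : ℝ, f (U + t • V) = p t) (hp : HasDerivAt p p' 0) :
    fderiv ℝ f U V = p' := by
  have hl : HasDerivAt (fun t : ℝ => U + t • V) V 0 := by
    simpa using ((hasDerivAt_id (0 : ℝ)).smul_const V).const_add U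
  have hf' : HasFDerivAt f (fderiv ℝ f U) (U + (0 : ℝ) • V) := by
    simpa using hf.hasFDerivAt
  have h := hf'.comp_hasDerivAt (0 : ℝ) hl
  rw [show f ∘ (fun t : ℝ => U + t • V) = p from funext hline] at h
  exact h.unique hp

theorem iteratedFDeriv_two_eq_of_line {E : Type*} [NormedAddCommGroup E] [NormedSpace ℝ E]
    {f : E → ℝ} (hf : ContDiff ℝ 2 f) {U V : E} {p p' : ℝ → ℝ} {p'' : ℝ}
    (hline : ∀ t : ℝ, f (U + t • V) = p t) (hp : ∀ t, HasDerivAt p (p' t) t)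
    (hp' : HasDerivAt p' p'' 0) :
    iteratedFDeriv ℝ 2 f U ![V, V] = p'' := by
  have h1 (t : ℝ) : fderiv ℝ f (U + t • V) V = p' t := by
    refine fderiv_apply_eq_of_line (hf.differentiable (by norm_num) _) (p := fun s => p (t + s))
      (fun s => ?_) ?_
    · rw [← hline, add_smul, add_assoc]
    · exact HasDerivAt.comp_const_add t 0 (by simpa using hp t)
  have hd : Differentiable ℝ (fderiv ℝ f) :=
    (hf.fderiv_right (m := 1) (by norm_num)).differentiable (by norm_num)
  rw [iteratedFDeriv_two_apply]
  have h2 := fderiv_apply_eq_of_line (f := fun x => fderiv ℝ f x V) (U := U)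
    ((hd U).clm_apply (differentiableAt_const V)) h1 hp'
  rw [fderiv_clm_apply (hd U) (differentiableAt_const V)] at h2
  simpa using h2

theorem exists_ne_zero_mulVec_eq_zero_of_lt {n k : ℕ} (h : n < k)
    (U : Matrix (Fin n) (Fin k) ℝ) : ∃ z : Fin k → ℝ, z ≠ 0 ∧ U *ᵥ z = 0 := by
  have h : LinearMap.ker U.mulVecLin ≠ ⊥ := LinearMap.ker_ne_bot_of_finrank_lt (by simpa using h)
  obtain ⟨z, hz, hz0⟩ := Submodule.exists_mem_ne_zero_of_ne_bot h
  exact ⟨z, hz0, by simpa using hz⟩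

/-- A linear functional nonnegative on rank-one squares is nonnegative on Gram matrices. -/
theorem nonneg_mul_transpose_of_nonneg_vecMulVec {n k : ℕ}
    (s : Matrix (Fin n) (Fin n) ℝ →ₗ[ℝ] ℝ)
    (hs : ∀ x : Fin n → ℝ, 0 ≤ s (vecMulVec x x)) (W : Matrix (Fin n) (Fin k) ℝ) :
    0 ≤ s (W * Wᵀ) := by
  have h : W * Wᵀ = ∑ j, vecMulVec (W.col j) (W.col j) := by
    ext a c
    simp [Matrix.mul_apply, Matrix.sum_apply, vecMulVec_apply]
  rw [h, map_sum]
  exact Finset.sum_nonneg fun j _ => hs _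

open scoped MatrixOrder in
theorem exists_eq_mul_transpose_of_posSemidef {n : ℕ} {X : Matrix (Fin n) (Fin n) ℝ}
    (hX : X.PosSemidef) : ∃ W : Matrix (Fin n) (Fin n) ℝ, X = W * Wᵀ := by
  obtain ⟨B, rfl⟩ := CStarAlgebra.nonneg_iff_eq_star_mul_self.1 hX.nonneg
  exact ⟨Bᵀ, by simp [star_eq_conjTranspose]⟩

/-- For the penalized objective
`L_μ(U) = ⟨C, UUᵀ⟩ + μ Σᵢ (⟨Aᵢ, UUᵀ⟩ − bᵢ)²` with `k ≥ n + 1`, every second-order stationary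
point `U` of `L_μ` is a global minimizer of `L_μ`, and `UUᵀ` is a global minimizer of
`F_μ(X) = ⟨C, X⟩ + μ Σᵢ (⟨Aᵢ, X⟩ − bᵢ)²` over the positive semidefinite cone. -/
theorem sosp_global_of_k_ge_n_succ {n m k : ℕ}
    (C : Matrix (Fin n) (Fin n) ℝ) (hC : C.IsSymm)
    (A : Fin m → Matrix (Fin n) (Fin n) ℝ) (hA : ∀ i, (A i).IsSymm)
    (b : Fin m → ℝ) (μ : ℝ) (hμ : 0 < μ) (hk : n + 1 ≤ k)
    (U : Matrix (Fin n) (Fin k) ℝ)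
    (hgrad : fderiv ℝ (fun V : Matrix (Fin n) (Fin k) ℝ =>
      mip C (V * Vᵀ) + μ * ∑ i, (mip (A i) (V * Vᵀ) - b i) ^ 2) U = 0)
    (hhess : ∀ V : Matrix (Fin n) (Fin k) ℝ,
      0 ≤ iteratedFDeriv ℝ 2 (fun W : Matrix (Fin n) (Fin k) ℝ =>
        mip C (W * Wᵀ) + μ * ∑ i, (mip (A i) (W * Wᵀ) - b i) ^ 2) U ![V, V]) :
    (∀ V : Matrix (Fin n) (Fin k) ℝ,
      mip C (U * Uᵀ) + μ * ∑ i, (mip (A i) (U * Uᵀ) - b i) ^ 2 ≤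
        mip C (V * Vᵀ) + μ * ∑ i, (mip (A i) (V * Vᵀ) - b i) ^ 2) ∧
    (∀ X : Matrix (Fin n) (Fin n) ℝ, X.PosSemidef →
      mip C (U * Uᵀ) + μ * ∑ i, (mip (A i) (U * Uᵀ) - b i) ^ 2 ≤
        mip C X + μ * ∑ i, (mip (A i) X - b i) ^ 2) := by
  change fderiv ℝ (fun V : Matrix (Fin n) (Fin k) ℝ => penalized C A b μ (V * Vᵀ)) U = 0 at hgrad
  change ∀ V : Matrix (Fin n) (Fin k) ℝ, 0 ≤ iteratedFDeriv ℝ 2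
    (fun W : Matrix (Fin n) (Fin k) ℝ => penalized C A b μ (W * Wᵀ)) U ![V, V] at hhess
  have hcd := contDiff_penalized_mul_transpose (k := k) C A b μ
  set s := penalizedDeriv C A b μ (U * Uᵀ) with hs_def
  have hsU : s (U * Uᵀ) = 0 := by
    set q := μ * ∑ i, mip (A i) (U * Uᵀ) ^ 2
    have hp : HasDerivAt (fun t : ℝ => penalized C A b μ (U * Uᵀ) + (2 * t + t ^ 2) * s (U * Uᵀ) +
        (2 * t + t ^ 2) ^ 2 * q) (2 * s (U * Uᵀ)) 0 := by
      have h0 : HasDerivAt (fun t : ℝ => 2 * t + t ^ 2) 2 0 := by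
        simpa using ((hasDerivAt_id (0 : ℝ)).const_mul 2).fun_add (hasDerivAt_pow 2 (0 : ℝ))
      simpa using ((h0.mul_const (s (U * Uᵀ))).const_add _).fun_add ((h0.fun_pow 2).mul_const q)
    have h := fderiv_apply_eq_of_line (U := U) (V := U)
      (hcd.differentiable (by norm_num) U) (fun t => by
        rw [← penalized_add_smul]
        congr 1
        simp only [Matrix.transpose_add, Matrix.transpose_smul, Matrix.add_mul, Matrix.mul_add,
          Matrix.smul_mul, Matrix.mul_smul]
        module) hp
    have h' := (DFunLike.congr_fun hgrad U).symm.trans h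
    simpa using h'.symm
  obtain ⟨z, hz, hUz⟩ := exists_ne_zero_mulVec_eq_zero_of_lt hk U
  have hzz : 0 < z ⬝ᵥ z := by
    simpa using Matrix.dotProduct_star_self_pos_iff.2 hz
  have hsx (x : Fin n → ℝ) : 0 ≤ s (vecMulVec x x) := by
    set V := vecMulVec x z with hV
    have hUV : U * Vᵀ = 0 := by
      rw [hV, transpose_vecMulVec, Matrix.mul_vecMulVec, hUz, zero_vecMulVec]
    have hVU : V * Uᵀ = 0 := by
      simpa using congrArg Matrix.transpose hUV
    have hVV : V * Vᵀ = (z ⬝ᵥ z) • vecMulVec x x := by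
      rw [hV, transpose_vecMulVec, vecMulVec_mul_vecMulVec, vecMulVec_smul]
    set q := μ * ∑ i, mip (A i) (V * Vᵀ) ^ 2
    have h := iteratedFDeriv_two_eq_of_line hcd (U := U) (V := V)
      (p := fun t => penalized C A b μ (U * Uᵀ) + t ^ 2 * s (V * Vᵀ) + (t ^ 2) ^ 2 * q)
      (p' := fun t => 2 * t * s (V * Vᵀ) + 2 * t ^ 2 * (2 * t) * q)
      (p'' := 2 * s (V * Vᵀ)) (fun t => by
        rw [← penalized_add_smul]
        congr 1
        simp only [Matrix.transpose_add, Matrix.transpose_smul, Matrix.add_mul, Matrix.mul_add,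
          Matrix.smul_mul, Matrix.mul_smul, hUV, hVU]
        module) (fun t => by
        have h0 : HasDerivAt (fun t : ℝ => t ^ 2) (2 * t) t := by
          simpa using hasDerivAt_pow 2 t
        simpa using ((h0.mul_const (s (V * Vᵀ))).const_add _).fun_add ((h0.fun_pow 2).mul_const q)) (by
        have h0 : HasDerivAt (fun t : ℝ => 2 * t) 2 0 := by
          simpa using (hasDerivAt_id (0 : ℝ)).const_mul 2
        have h1 : HasDerivAt (fun t : ℝ => 2 * t ^ 2) 0 0 := by
          simpa using (hasDerivAt_pow 2 (0 : ℝ)).const_mul 2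
        simpa using (h0.mul_const (s (V * Vᵀ))).fun_add ((h1.fun_mul h0).mul_const q))
    have h2 := hhess V
    rw [h, hVV, map_smul, smul_eq_mul] at h2
    exact (mul_nonneg_iff_of_pos_left hzz).1 (by linarith)
  have key {l : ℕ} (W : Matrix (Fin n) (Fin l) ℝ) :
      penalized C A b μ (U * Uᵀ) ≤ penalized C A b μ (W * Wᵀ) := by
    have h := penalized_add_smul C A b μ (U * Uᵀ) (W * Wᵀ - U * Uᵀ) 1
    rw [one_smul, add_sub_cancel, ← hs_def, map_sub, hsU] at h
    have h1 := nonneg_mul_transpose_of_nonneg_vecMulVec s hsx W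
    have h2 : 0 ≤ μ * ∑ i, mip (A i) (W * Wᵀ - U * Uᵀ) ^ 2 := by positivity
    linarith
  refine ⟨fun V => key V, fun X hX => ?_⟩
  obtain ⟨W, rfl⟩ := exists_eq_mul_transpose_of_posSemidef hX
  exact key W
end

section
/- Let C, A₁, …, A_m ∈ Sym(n), b ∈ ℝ^m, μ > 0, and define 𝒜 : Sym(n) → ℝ^m by 𝒜(X)_i = ⟨A_i,X⟩, with adjoint 𝒜*(y) = Σ_i y_i A_i, and L_μ(U) = ⟨C, UUᵀ⟩ + μ ‖𝒜(UUᵀ) − b‖₂². If U ∈ ℝ^{n×k} is a first-order stationary point of L_μ, then (C + 2μ 𝒜*(𝒜(UUᵀ) − b)) U = 0; consequently rank(U) ≤ null(C + 2μ 𝒜*(𝒜(UUᵀ) − b)) ≤ max_{y ∈ ℝ^m} null(C + 𝒜*(y)), where null(M) denotes the dimension of the kernel of M. -/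
open Matrix

attribute [local instance] Matrix.normedAddCommGroup Matrix.normedSpace

/-- Nullity (kernel dimension) of a square matrix. -/
noncomputable def nullity {n : ℕ} (M : Matrix (Fin n) (Fin n) ℝ) : ℕ :=
  Module.finrank ℝ (LinearMap.ker M.mulVecLin)

theorem differentiable_mip_mul_transpose {n k : ℕ} (M : Matrix (Fin n) (Fin n) ℝ) :
    Differentiable ℝ (fun V : Matrix (Fin n) (Fin k) ℝ => mip M (V * Vᵀ)) := by
  have entry : ∀ i j, Differentiable ℝ (fun V : Matrix (Fin n) (Fin k) ℝ => V i j) := fun i j =>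
    (LinearMap.toContinuousLinearMap (Matrix.entryLinearMap ℝ ℝ i j)).differentiable
  simp only [mip, Matrix.trace, Matrix.diag_apply, Matrix.mul_apply, Matrix.transpose_apply]
  fun_prop

theorem mip_line {n k : ℕ} {M : Matrix (Fin n) (Fin n) ℝ} (hM : M.IsSymm)
    (U H : Matrix (Fin n) (Fin k) ℝ) (t : ℝ) :
    mip M ((U + t • H) * (U + t • H)ᵀ) =
      mip M (U * Uᵀ) + t * (2 * mip M (H * Uᵀ)) + t ^ 2 * mip M (H * Hᵀ) := by
  have key : (M * (U * Hᵀ)).trace = (M * (H * Uᵀ)).trace := by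
    rw [← Matrix.trace_transpose (M * (U * Hᵀ))]
    simp only [Matrix.transpose_mul, Matrix.transpose_transpose, hM.eq]
    exact Matrix.trace_mul_comm _ _
  simp only [mip, hM.eq, Matrix.transpose_add, Matrix.transpose_smul, Matrix.add_mul,
    Matrix.mul_add, Matrix.smul_mul, Matrix.mul_smul, Matrix.trace_add, Matrix.trace_smul,
    smul_eq_mul, key]
  ring

theorem hasDerivAt_mip_line {n k : ℕ} {M : Matrix (Fin n) (Fin n) ℝ} (hM : M.IsSymm)
    (U H : Matrix (Fin n) (Fin k) ℝ) :
    HasDerivAt (fun t : ℝ => mip M ((U + t • H) * (U + t • H)ᵀ)) (2 * mip M (H * Uᵀ)) 0 := by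
  simp only [mip_line hM]
  have h := (((hasDerivAt_id (0 : ℝ)).mul_const (2 * mip M (H * Uᵀ))).const_add
    (mip M (U * Uᵀ))).add (((hasDerivAt_id (0 : ℝ)).pow 2).mul_const (mip M (H * Hᵀ)))
  exact h.congr_deriv (by simp)

theorem rank_le_nullity_of_mul_eq_zero {n k : ℕ} {M : Matrix (Fin n) (Fin n) ℝ}
    {U : Matrix (Fin n) (Fin k) ℝ} (h : M * U = 0) : U.rank ≤ nullity M := by
  refine Submodule.finrank_mono ?_
  rintro _ ⟨x, rfl⟩
  simp [h]

/-- If `U` is a first-order stationary point of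
`L_μ(U) = ⟨C, UUᵀ⟩ + μ ‖𝒜(UUᵀ) − b‖₂²`, then `(C + 2μ 𝒜*(𝒜(UUᵀ) − b)) U = 0`; consequently
`rank U ≤ null(C + 2μ 𝒜*(𝒜(UUᵀ) − b)) ≤ max_y null(C + 𝒜*(y))`. -/
theorem fosp_rank_le_nullity {n m k : ℕ}
    (C : Matrix (Fin n) (Fin n) ℝ) (hC : C.IsSymm)
    (A : Fin m → Matrix (Fin n) (Fin n) ℝ) (hA : ∀ i, (A i).IsSymm)
    (b : Fin m → ℝ) (μ : ℝ) (hμ : 0 < μ)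
    (U : Matrix (Fin n) (Fin k) ℝ)
    (hgrad : fderiv ℝ (fun V : Matrix (Fin n) (Fin k) ℝ =>
      mip C (V * Vᵀ) + μ * ∑ i, (mip (A i) (V * Vᵀ) - b i) ^ 2) U = 0) :
    (C + (2 * μ) • ∑ i, (mip (A i) (U * Uᵀ) - b i) • A i) * U = 0 ∧
    U.rank ≤ nullity (C + (2 * μ) • ∑ i, (mip (A i) (U * Uᵀ) - b i) • A i) ∧
    (nullity (C + (2 * μ) • ∑ i, (mip (A i) (U * Uᵀ) - b i) • A i) : ℕ∞) ≤
      ⨆ y : Fin m → ℝ, (nullity (C + ∑ i, y i • A i) : ℕ∞) := by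
  set G := C + (2 * μ) • ∑ i, (mip (A i) (U * Uᵀ) - b i) • A i with hG
  have hGU : G * U = 0 := by
    have hdiff : DifferentiableAt ℝ (fun V : Matrix (Fin n) (Fin k) ℝ =>
        mip C (V * Vᵀ) + μ * ∑ i, (mip (A i) (V * Vᵀ) - b i) ^ 2) U := by
      have hmip := fun M : Matrix (Fin n) (Fin n) ℝ =>
        differentiable_mip_mul_transpose (k := k) M
      fun_prop
    have hline : HasDerivAt (fun t : ℝ => U + t • (G * U)) (G * U) 0 :=
      (((hasDerivAt_id (0 : ℝ)).smul_const (G * U)).const_add U).congr_deriv (one_smul ℝ _)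
    have hzero := hdiff.hasFDerivAt.comp_hasDerivAt_of_eq 0 hline (by simp)
    rw [hgrad] at hzero
    have hderiv := (hasDerivAt_mip_line hC U (G * U)).add ((HasDerivAt.fun_sum
      fun i (_ : i ∈ Finset.univ) =>
        ((hasDerivAt_mip_line (hA i) U (G * U)).sub_const (b i)).pow 2).const_mul μ)
    have heq := (hderiv.unique hzero).trans (show _ = (0 : ℝ) from rfl)
    have htrace : mip G (G * U * Uᵀ) = 0 := by
      have hexpand : mip G (G * U * Uᵀ) = mip C (G * U * Uᵀ) +
          2 * μ * ∑ i, (mip (A i) (U * Uᵀ) - b i) * mip (A i) (G * U * Uᵀ) := by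
        generalize G * U * Uᵀ = X
        simp [hG, mip, Matrix.transpose_sum, Matrix.add_mul, Matrix.sum_mul, Matrix.trace_sum]
      rw [hexpand]
      simp only [zero_smul, add_zero] at heq
      have hsum : ∑ i, (2 : ℕ) * (mip (A i) (U * Uᵀ) - b i) ^ (2 - 1) *
          (2 * mip (A i) (G * U * Uᵀ)) =
          4 * ∑ i, (mip (A i) (U * Uᵀ) - b i) * mip (A i) (G * U * Uᵀ) := by
        rw [Finset.mul_sum]
        refine Finset.sum_congr rfl fun i _ => ?_
        norm_num
        ring
      rw [hsum] at heq
      linarith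
    refine Matrix.trace_conjTranspose_mul_self_eq_zero_iff.mp ?_
    rw [Matrix.conjTranspose_eq_transpose_of_trivial, Matrix.transpose_mul, Matrix.mul_assoc,
      Matrix.trace_mul_comm, Matrix.mul_assoc, ← htrace, mip]
  refine ⟨hGU, rank_le_nullity_of_mul_eq_zero hGU, ?_⟩
  refine le_iSup_of_le (fun i => 2 * μ * (mip (A i) (U * Uᵀ) - b i)) (le_of_eq ?_)
  simp only [hG, Finset.smul_sum, smul_smul]
end

section
/- Let A₁,…,A_m ∈ Sym(n), b ∈ ℝ^m, 𝒜(X)_i = ⟨A_i,X⟩, and suppose the feasible set 𝒞 = {X ⪰ 0 : 𝒜(X) = b} is non-empty. Then 𝒞 is compact if and only if there exist a positive definite symmetric matrix A₀ and a real number b₀ ≥ 0 such that ⟨A₀, X⟩ = b₀ for every X ∈ 𝒞. Furthermore, in that case, if 𝒞 ≠ {0} then b₀ > 0. -/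
open Matrix

attribute [local instance] Matrix.normedAddCommGroup Matrix.normedSpace

section TraceInnerProduct

variable {n : ℕ}

lemma mip_add_right (A X Y : Matrix (Fin n) (Fin n) ℝ) : mip A (X + Y) = mip A X + mip A Y := by
  simp [mip, Matrix.mul_add]

lemma mip_smul_right (A X : Matrix (Fin n) (Fin n) ℝ) (c : ℝ) : mip A (c • X) = c * mip A X := by
  simp [mip]

lemma mip_sum_right {ι : Type*} (s : Finset ι) (A : Matrix (Fin n) (Fin n) ℝ)
    (X : ι → Matrix (Fin n) (Fin n) ℝ) : mip A (∑ i ∈ s, X i) = ∑ i ∈ s, mip A (X i) := by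
  simp [mip, Matrix.mul_sum, Matrix.trace_sum]

lemma mip_sum_smul_left {ι : Type*} (s : Finset ι) (c : ι → ℝ)
    (A : ι → Matrix (Fin n) (Fin n) ℝ) (X : Matrix (Fin n) (Fin n) ℝ) :
    mip (∑ i ∈ s, c i • A i) X = ∑ i ∈ s, c i * mip (A i) X := by
  simp [mip, Matrix.transpose_sum, Matrix.sum_mul, Matrix.trace_sum]

lemma mip_vecMulVec (A : Matrix (Fin n) (Fin n) ℝ) (v : Fin n → ℝ) :
    mip A (vecMulVec v v) = v ⬝ᵥ (A *ᵥ v) := by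
  rw [mip, Matrix.mul_vecMulVec, Matrix.trace_vecMulVec, Matrix.mulVec_transpose,
    ← Matrix.dotProduct_mulVec]

lemma continuous_mip_right (A : Matrix (Fin n) (Fin n) ℝ) : Continuous (mip A) := by
  unfold mip
  fun_prop

lemma mip_pos {A X : Matrix (Fin n) (Fin n) ℝ} (hA : A.PosDef) (hX : X.PosSemidef)
    (hX0 : X ≠ 0) : 0 < mip A X := by
  obtain ⟨k, v, rfl⟩ := Matrix.posSemidef_iff_eq_sum_vecMulVec.mp hX
  simp only [star_trivial] at hX0 ⊢
  rw [mip_sum_right]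
  obtain ⟨i, hi⟩ : ∃ i, v i ≠ 0 := by
    by_contra! h
    exact hX0 (by simp [h])
  simp only [mip_vecMulVec]
  refine Finset.sum_pos' (fun j _ ↦ ?_) ⟨i, Finset.mem_univ i, ?_⟩
  · simpa using hA.posSemidef.dotProduct_mulVec_nonneg (v j)
  · simpa using hA.dotProduct_mulVec_pos hi

lemma mip_nonneg {A X : Matrix (Fin n) (Fin n) ℝ} (hA : A.PosDef) (hX : X.PosSemidef) :
    0 ≤ mip A X := by
  rcases eq_or_ne X 0 with rfl | hX0
  · simp [mip]
  · exact (mip_pos hA hX hX0).le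

lemma isClosed_setOf_posSemidef : IsClosed {X : Matrix (Fin n) (Fin n) ℝ | X.PosSemidef} := by
  simp only [Matrix.posSemidef_iff_dotProduct_mulVec, Set.ofPred_and, Set.ofPred_forall]
  refine IsClosed.inter ?_ (isClosed_iInter fun x ↦ ?_)
  · exact isClosed_eq (by fun_prop) continuous_id
  · exact isClosed_le continuous_const (by fun_prop)

lemma exists_pos_mul_norm_le_mip {A : Matrix (Fin n) (Fin n) ℝ} (hA : A.PosDef) :
    ∃ c > 0, ∀ X : Matrix (Fin n) (Fin n) ℝ, X.PosSemidef → c * ‖X‖ ≤ mip A X := by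
  have : ProperSpace (Matrix (Fin n) (Fin n) ℝ) := FiniteDimensional.proper_real _
  set K := {X : Matrix (Fin n) (Fin n) ℝ | X.PosSemidef} ∩ Metric.sphere 0 1
  have hK : IsCompact K := (isCompact_sphere _ _).inter_left isClosed_setOf_posSemidef
  obtain ⟨c, hc, hcK⟩ : ∃ c > 0, ∀ X ∈ K, c ≤ mip A X := by
    rcases K.eq_empty_or_nonempty with h | h
    · exact ⟨1, one_pos, by simp [h]⟩
    · obtain ⟨X, hX, hmin⟩ := hK.exists_isMinOn h (continuous_mip_right A).continuousOn
      exact ⟨mip A X, mip_pos hA hX.1 (ne_zero_of_mem_unit_sphere ⟨X, hX.2⟩), fun Y hY ↦ hmin hY⟩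
  refine ⟨c, hc, fun X hX ↦ ?_⟩
  rcases eq_or_ne X 0 with rfl | hX0
  · simp [mip]
  have hpos : 0 < ‖X‖ := norm_pos_iff.mpr hX0
  have h := hcK (‖X‖⁻¹ • X) ⟨hX.smul (inv_nonneg.mpr hpos.le), by simp [norm_smul, hpos.ne']⟩
  rwa [mip_smul_right, inv_mul_eq_div, le_div_iff₀ hpos] at h

lemma isCompact_of_isClosed_of_mip_eq {A : Matrix (Fin n) (Fin n) ℝ} (hA : A.PosDef) {b : ℝ}
    {S : Set (Matrix (Fin n) (Fin n) ℝ)} (hS : IsClosed S)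
    (h : ∀ X ∈ S, X.PosSemidef ∧ mip A X = b) : IsCompact S := by
  have : ProperSpace (Matrix (Fin n) (Fin n) ℝ) := FiniteDimensional.proper_real _
  obtain ⟨c, hc, hcX⟩ := exists_pos_mul_norm_le_mip hA
  refine Metric.isCompact_of_isClosed_isBounded hS
    (isBounded_iff_forall_norm_le.mpr ⟨b / c, fun X hX ↦ ?_⟩)
  rw [le_div_iff₀' hc, ← (h X hX).2]
  exact hcX X (h X hX).1

lemma isClosed_feasible {m : ℕ} (A : Fin m → Matrix (Fin n) (Fin n) ℝ) (b : Fin m → ℝ) :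
    IsClosed {X : Matrix (Fin n) (Fin n) ℝ | X.PosSemidef ∧ ∀ i, mip (A i) X = b i} := by
  simp only [Set.ofPred_and, Set.ofPred_forall]
  exact isClosed_setOf_posSemidef.inter
    (isClosed_iInter fun i ↦ isClosed_eq (continuous_mip_right (A i)) continuous_const)

/-- A compact non-empty feasible set has no non-zero recession direction. -/
lemma eq_zero_of_isCompact_feasible {m : ℕ} {A : Fin m → Matrix (Fin n) (Fin n) ℝ}
    {b : Fin m → ℝ}
    (hne : {X : Matrix (Fin n) (Fin n) ℝ | X.PosSemidef ∧ ∀ i, mip (A i) X = b i}.Nonempty)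
    (hC : IsCompact {X : Matrix (Fin n) (Fin n) ℝ | X.PosSemidef ∧ ∀ i, mip (A i) X = b i})
    {D : Matrix (Fin n) (Fin n) ℝ} (hD : D.PosSemidef) (hAD : ∀ i, mip (A i) D = 0) : D = 0 := by
  by_contra hD0
  have hpos : 0 < ‖D‖ := norm_pos_iff.mpr hD0
  obtain ⟨X, hX, hAX⟩ := hne
  obtain ⟨R, hR⟩ := isBounded_iff_forall_norm_le.mp hC.isBounded
  have hR0 : 0 ≤ R := (norm_nonneg X).trans (hR X ⟨hX, hAX⟩)
  set t := (R + ‖X‖ + 1) / ‖D‖ with ht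
  have ht0 : 0 ≤ t := by positivity
  have hle := hR (X + t • D) ⟨hX.add (hD.smul ht0), fun i ↦ by
    rw [mip_add_right, mip_smul_right, hAD, hAX, mul_zero, add_zero]⟩
  have htD : ‖t • D‖ = R + ‖X‖ + 1 := by
    rw [norm_smul, Real.norm_of_nonneg ht0, ht, div_mul_cancel₀ _ hpos.ne']
  have := norm_sub_le (X + t • D) X
  rw [add_sub_cancel_left] at this
  linarith

/-- If no non-zero positive semidefinite matrix is orthogonal to all the symmetric matrices `A i`,
then some linear combination of them is positive definite. -/
lemma exists_posDef_sum_smul {m : ℕ} {A : Fin m → Matrix (Fin n) (Fin n) ℝ}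
    (hA : ∀ i, (A i).IsSymm)
    (h : ∀ D : Matrix (Fin n) (Fin n) ℝ, D.PosSemidef → (∀ i, mip (A i) D = 0) → D = 0) :
    ∃ y : Fin m → ℝ, (∑ i, y i • A i).PosDef := by
  set S := {X : Matrix (Fin n) (Fin n) ℝ | X.PosSemidef ∧ mip 1 X = 1}
  have hS : IsCompact S := isCompact_of_isClosed_of_mip_eq Matrix.PosDef.one
    (isClosed_setOf_posSemidef.inter
      (isClosed_eq (continuous_mip_right 1) continuous_const)) fun _ hX ↦ hX
  have hSconv : Convex ℝ S := by
    rintro X ⟨hX, hX1⟩ Y ⟨hY, hY1⟩ s t hs ht hst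
    refine ⟨(hX.smul hs).add (hY.smul ht), ?_⟩
    rw [mip_add_right, mip_smul_right, mip_smul_right, hX1, hY1, mul_one, mul_one, hst]
  let L : Matrix (Fin n) (Fin n) ℝ →ₗ[ℝ] (Fin m → ℝ) :=
    { toFun X i := mip (A i) X
      map_add' X Y := funext fun i ↦ mip_add_right (A i) X Y
      map_smul' c X := funext fun i ↦ mip_smul_right (A i) X c }
  have hL : Continuous L := continuous_pi fun i ↦ continuous_mip_right (A i)
  have h0 : (0 : Fin m → ℝ) ∉ L '' S := by
    rintro ⟨D, ⟨hD, hD1⟩, hLD⟩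
    rw [h D hD (congrFun hLD)] at hD1
    simp [mip] at hD1
  obtain ⟨f, u, hfu, hf⟩ := geometric_hahn_banach_point_closed (hSconv.linear_image L)
    (hS.image hL).isClosed h0
  rw [map_zero] at hfu
  set y : Fin m → ℝ := fun i ↦ f (Pi.single i 1)
  have hy (X : Matrix (Fin n) (Fin n) ℝ) : mip (∑ i, y i • A i) X = f (L X) := by
    rw [mip_sum_smul_left, ← f.coe_coe, LinearMap.pi_apply_eq_sum_univ]
    refine Finset.sum_congr rfl fun i _ ↦ ?_
    have hi : (Pi.single i 1 : Fin m → ℝ) = fun j ↦ if i = j then 1 else 0 := by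
      ext j
      simp [Pi.single_apply, eq_comm]
    rw [smul_eq_mul, mul_comm, ← hi]
    rfl
  refine ⟨y, .of_dotProduct_mulVec_pos ?_ fun v hv ↦ ?_⟩
  · simp only [Matrix.IsHermitian, Matrix.conjTranspose_eq_transpose_of_trivial,
      Matrix.transpose_sum, Matrix.transpose_smul, (hA _).eq]
  · have hv2 : 0 < v ⬝ᵥ v := by simpa using Matrix.dotProduct_star_self_pos_iff.mpr hv
    have hvS : (v ⬝ᵥ v)⁻¹ • vecMulVec v v ∈ S := by
      refine ⟨Matrix.PosSemidef.smul ?_ (inv_nonneg.mpr hv2.le), ?_⟩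
      · simpa using Matrix.posSemidef_vecMulVec_self_star v
      · rw [mip_smul_right, mip_vecMulVec, Matrix.one_mulVec, inv_mul_cancel₀ hv2.ne']
    have := hfu.trans (hf _ ⟨_, hvS, rfl⟩)
    rw [← hy, mip_smul_right, mip_vecMulVec] at this
    simpa using (pos_iff_pos_of_mul_pos this).mp (inv_pos.mpr hv2)

end TraceInnerProduct


/-- For a non-empty feasible set `𝒞 = {X ⪰ 0 : 𝒜(X) = b}`:
`𝒞` is compact iff there are `A₀ ≻ 0` and `b₀ ≥ 0` with `⟨A₀, X⟩ = b₀` on `𝒞`;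
furthermore, for any such pair, if `𝒞 ≠ {0}` then `b₀ > 0`. -/
theorem compact_iff_redundant_constraint {n m : ℕ}
    (A : Fin m → Matrix (Fin n) (Fin n) ℝ) (hA : ∀ i, (A i).IsSymm) (b : Fin m → ℝ)
    (hne : {X : Matrix (Fin n) (Fin n) ℝ | X.PosSemidef ∧ ∀ i, mip (A i) X = b i}.Nonempty) :
    (IsCompact {X : Matrix (Fin n) (Fin n) ℝ | X.PosSemidef ∧ ∀ i, mip (A i) X = b i} ↔
      ∃ (A₀ : Matrix (Fin n) (Fin n) ℝ) (b₀ : ℝ), A₀.PosDef ∧ 0 ≤ b₀ ∧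
        ∀ X ∈ {X : Matrix (Fin n) (Fin n) ℝ | X.PosSemidef ∧ ∀ i, mip (A i) X = b i},
          mip A₀ X = b₀) ∧
    (∀ (A₀ : Matrix (Fin n) (Fin n) ℝ) (b₀ : ℝ), A₀.PosDef → 0 ≤ b₀ →
      (∀ X ∈ {X : Matrix (Fin n) (Fin n) ℝ | X.PosSemidef ∧ ∀ i, mip (A i) X = b i},
        mip A₀ X = b₀) →
      {X : Matrix (Fin n) (Fin n) ℝ | X.PosSemidef ∧ ∀ i, mip (A i) X = b i} ≠ {0} →
      0 < b₀) := by
  refine ⟨⟨fun hC ↦ ?_, ?_⟩, fun A₀ b₀ hA₀ hb₀ h hC ↦ ?_⟩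
  · obtain ⟨y, hy⟩ := exists_posDef_sum_smul hA fun D hD hAD ↦
      eq_zero_of_isCompact_feasible hne hC hD hAD
    have hval : ∀ X ∈ {X : Matrix (Fin n) (Fin n) ℝ | X.PosSemidef ∧ ∀ i, mip (A i) X = b i},
        mip (∑ i, y i • A i) X = ∑ i, y i * b i := by
      rintro X ⟨-, hX⟩
      simp only [mip_sum_smul_left, hX]
    obtain ⟨X, hX⟩ := hne
    exact ⟨_, _, hy, hval X hX ▸ mip_nonneg hy hX.1, hval⟩
  · rintro ⟨A₀, b₀, hA₀, -, h⟩
    exact isCompact_of_isClosed_of_mip_eq hA₀ (isClosed_feasible A b) fun X hX ↦ ⟨hX.1, h X hX⟩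
  · obtain ⟨X, hX, hX0⟩ : ∃ X ∈ {X : Matrix (Fin n) (Fin n) ℝ | X.PosSemidef ∧
        ∀ i, mip (A i) X = b i}, X ≠ 0 := by
      by_contra! hall
      exact hC (hne.subset_singleton_iff.mp hall)
    exact h X hX ▸ mip_pos hA₀ hX.1 hX0
end
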